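/- Let 0 < β < 1. Assume the core energies Q_GL, Q_{[1,1]}(β) and Q_{[1,0]}(β) exist and that Q_{[1,1]}(β) ≤ 2·Q_{[1,0]}(β); assume also that for each ε ∈ (0,1) there is a map u_ε, admissible for the scalar problem, with G_ε(u_ε) = I_GL(ε) and (1/ε²)·∫_{D₁}(1−|u_ε|²)² dx → 2π as ε → 0⁺. For each ε ∈ (0,1) let Ψ_ε be admissible with degrees (1,1) with E_ε(Ψ_ε) = I_{[1,1]}(ε;β), and let S_ε denote the spin of Ψ_ε. Then liminf_{ε→0⁺} (1/ε²)·∫_{D₁} S_ε² dx ≥ π/4. -/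

import Mathlib

open MeasureTheory Metric Set Filter Complex

noncomputable section

/-- Sum of squared norms of the two first-order partial derivatives (plane identified with `ℂ`). -/
def gradSq (f : ℂ → ℂ) (x : ℂ) : ℝ :=
  ‖fderiv ℝ f x 1‖ ^ 2 + ‖fderiv ℝ f x Complex.I‖ ^ 2

/-- Two-component Ginzburg–Landau energy density on the unit disk. -/
def eDen (ε β : ℝ) (ψp ψm : ℂ → ℂ) (x : ℂ) : ℝ :=
  (1 / 2) * (gradSq ψp x + gradSq ψm x)
    + (1 / (4 * ε ^ 2)) * ((‖ψp x‖ ^ 2 + ‖ψm x‖ ^ 2 - 1) ^ 2)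
    + (β / (4 * ε ^ 2)) * ((‖ψp x‖ ^ 2 - ‖ψm x‖ ^ 2) ^ 2)

/-- Two-component Ginzburg–Landau energy on the unit disk. -/
def En (ε β : ℝ) (ψp ψm : ℂ → ℂ) : ℝ := ∫ x in ball (0 : ℂ) 1, eDen ε β ψp ψm x

/-- Scalar Ginzburg–Landau energy density. -/
def gDen (ε : ℝ) (u : ℂ → ℂ) (x : ℂ) : ℝ :=
  (1 / 2) * gradSq u x + (1 / (4 * ε ^ 2)) * ((1 - ‖u x‖ ^ 2) ^ 2)

/-- Scalar Ginzburg–Landau energy on the unit disk. -/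
def Gn (ε : ℝ) (u : ℂ → ℂ) : ℝ := ∫ x in ball (0 : ℂ) 1, gDen ε u x

/-- Admissible two-component map with boundary degrees `(np, nm)`. -/
def AdmissiblePair (ε β : ℝ) (np nm : ℕ) (ψp ψm : ℂ → ℂ) : Prop :=
  ContinuousOn ψp (closedBall 0 1) ∧ ContinuousOn ψm (closedBall 0 1) ∧
  ContDiffOn ℝ 1 ψp (ball 0 1) ∧ ContDiffOn ℝ 1 ψm (ball 0 1) ∧
  IntegrableOn (eDen ε β ψp ψm) (ball 0 1) ∧
  ∀ x : ℂ, ‖x‖ = 1 →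
    ψp x = (Real.sqrt 2 : ℂ)⁻¹ * x ^ np ∧ ψm x = (Real.sqrt 2 : ℂ)⁻¹ * x ^ nm

/-- The infimum `I_{[np,nm]}(ε;β)`. -/
def Ival (ε β : ℝ) (np nm : ℕ) : ℝ :=
  sInf { e : ℝ | ∃ ψp ψm : ℂ → ℂ, AdmissiblePair ε β np nm ψp ψm ∧ e = En ε β ψp ψm }

/-- Admissible scalar map with degree-one boundary condition. -/
def AdmissibleScalar (ε : ℝ) (u : ℂ → ℂ) : Prop :=
  ContinuousOn u (closedBall 0 1) ∧ ContDiffOn ℝ 1 u (ball 0 1) ∧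
  IntegrableOn (gDen ε u) (ball 0 1) ∧ ∀ x : ℂ, ‖x‖ = 1 → u x = x

/-- The infimum `I_GL(ε)`. -/
def IGL (ε : ℝ) : ℝ :=
  sInf { e : ℝ | ∃ u : ℂ → ℂ, AdmissibleScalar ε u ∧ e = Gn ε u }

/-- Spin of a two-component map. -/
def spin (ψp ψm : ℂ → ℂ) (x : ℂ) : ℝ := (1 / 2) * (‖ψm x‖ ^ 2 - ‖ψp x‖ ^ 2)

lemma gradSq_nonneg (f : ℂ → ℂ) (x : ℂ) : 0 ≤ gradSq f x := by
  unfold gradSq; positivity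

lemma gradSq_const_mul (c : ℂ) (f : ℂ → ℂ) (x : ℂ) :
    gradSq (fun y => c * f y) x = ‖c‖ ^ 2 * gradSq f x := by
  have h : fderiv ℝ (fun y => c * f y) x = c • fderiv ℝ f x :=
    congrFun (fderiv_const_smul_field (𝕜 := ℝ) (f := f) c) x
  simp only [gradSq, h, smul_apply, norm_smul]
  ring

lemma gradSq_const (c x : ℂ) : gradSq (fun _ => c) x = 0 := by
  simp [gradSq]

lemma continuousOn_gradSq {f : ℂ → ℂ} {s : Set ℂ} (hs : IsOpen s) (hf : ContDiffOn ℝ 1 f s) :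
    ContinuousOn (gradSq f) s := by
  have h := hf.continuousOn_fderiv_of_isOpen hs le_rfl
  unfold gradSq
  exact ((h.clm_apply continuousOn_const).norm.pow 2).add
    ((h.clm_apply continuousOn_const).norm.pow 2)

lemma integrableOn_ball_of_continuousOn_closedBall {f : ℂ → ℝ}
    (hf : ContinuousOn f (closedBall 0 1)) : IntegrableOn f (ball 0 1) :=
  (hf.integrableOn_compact (isCompact_closedBall 0 1)).mono_set ball_subset_closedBall

section Pair

variable {ε β : ℝ} {np nm : ℕ} {ψp ψm : ℂ → ℂ}

lemma AdmissiblePair.integrableOn_total (h : AdmissiblePair ε β np nm ψp ψm) :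
    IntegrableOn (fun x => (‖ψp x‖ ^ 2 + ‖ψm x‖ ^ 2 - 1) ^ 2) (ball 0 1) :=
  integrableOn_ball_of_continuousOn_closedBall
    ((((h.1.norm.pow 2).add (h.2.1.norm.pow 2)).sub continuousOn_const).pow 2)

lemma AdmissiblePair.integrableOn_diff (h : AdmissiblePair ε β np nm ψp ψm) :
    IntegrableOn (fun x => (‖ψp x‖ ^ 2 - ‖ψm x‖ ^ 2) ^ 2) (ball 0 1) :=
  integrableOn_ball_of_continuousOn_closedBall
    (((h.1.norm.pow 2).sub (h.2.1.norm.pow 2)).pow 2)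

lemma AdmissiblePair.integrableOn_gradSq_add (h : AdmissiblePair ε β np nm ψp ψm) :
    IntegrableOn (fun x => gradSq ψp x + gradSq ψm x) (ball 0 1) := by
  have h3 := ((h.2.2.2.2.1.sub (h.integrableOn_total.const_mul (1 / (4 * ε ^ 2)))).sub
    (h.integrableOn_diff.const_mul (β / (4 * ε ^ 2)))).const_mul 2
  refine h3.congr (Eventually.of_forall fun x => ?_)
  simp only [eDen, Pi.sub_apply]
  ring

lemma AdmissiblePair.integrableOn_gradSq_fst (h : AdmissiblePair ε β np nm ψp ψm) :
    IntegrableOn (gradSq ψp) (ball 0 1) := by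
  refine h.integrableOn_gradSq_add.mono'
    ((continuousOn_gradSq isOpen_ball h.2.2.1).aestronglyMeasurable measurableSet_ball)
    (Eventually.of_forall fun x => ?_)
  rw [Real.norm_of_nonneg (gradSq_nonneg _ _)]
  exact le_add_of_nonneg_right (gradSq_nonneg _ _)

lemma AdmissiblePair.integrableOn_gradSq_snd (h : AdmissiblePair ε β np nm ψp ψm) :
    IntegrableOn (gradSq ψm) (ball 0 1) := by
  refine h.integrableOn_gradSq_add.mono'
    ((continuousOn_gradSq isOpen_ball h.2.2.2.1).aestronglyMeasurable measurableSet_ball)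
    (Eventually.of_forall fun x => ?_)
  rw [Real.norm_of_nonneg (gradSq_nonneg _ _)]
  exact le_add_of_nonneg_left (gradSq_nonneg _ _)

lemma AdmissiblePair.change_params (h : AdmissiblePair ε β np nm ψp ψm) (ε' β' : ℝ) :
    AdmissiblePair ε' β' np nm ψp ψm :=
  ⟨h.1, h.2.1, h.2.2.1, h.2.2.2.1,
    ((h.integrableOn_gradSq_add.const_mul (1 / 2)).add
      (h.integrableOn_total.const_mul (1 / (4 * ε' ^ 2)))).add
      (h.integrableOn_diff.const_mul (β' / (4 * ε' ^ 2))), h.2.2.2.2.2⟩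

lemma AdmissiblePair.En_eq (h : AdmissiblePair ε β np nm ψp ψm) :
    En ε β ψp ψm = (1 / 2) * (∫ x in ball (0 : ℂ) 1, (gradSq ψp x + gradSq ψm x))
      + (1 / (4 * ε ^ 2)) * (∫ x in ball (0 : ℂ) 1, (‖ψp x‖ ^ 2 + ‖ψm x‖ ^ 2 - 1) ^ 2)
      + (β / (4 * ε ^ 2)) * (∫ x in ball (0 : ℂ) 1, (‖ψp x‖ ^ 2 - ‖ψm x‖ ^ 2) ^ 2) := by
  have h1 := h.integrableOn_gradSq_add.const_mul (1 / 2)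
  have h2 := h.integrableOn_total.const_mul (1 / (4 * ε ^ 2))
  have h3 := h.integrableOn_diff.const_mul (β / (4 * ε ^ 2))
  simp only [En, eDen]
  rw [integral_add (by exact h1.add h2) h3, integral_add h1 h2]
  simp only [integral_const_mul]

lemma Ival_le_En (hβ : 0 ≤ β) (h : AdmissiblePair ε β np nm ψp ψm) :
    Ival ε β np nm ≤ En ε β ψp ψm := by
  refine csInf_le ⟨0, ?_⟩ ⟨ψp, ψm, h, rfl⟩
  rintro e ⟨p, m, -, rfl⟩
  refine integral_nonneg fun x => ?_
  have := gradSq_nonneg p x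
  have := gradSq_nonneg m x
  simp only [eDen, Pi.zero_apply]
  positivity

end Pair

lemma IGL_le_Gn {ε : ℝ} {u : ℂ → ℂ} (h : AdmissibleScalar ε u) : IGL ε ≤ Gn ε u := by
  refine csInf_le ⟨0, ?_⟩ ⟨u, h, rfl⟩
  rintro e ⟨v, -, rfl⟩
  refine integral_nonneg fun x => ?_
  have := gradSq_nonneg v x
  simp only [gDen, Pi.zero_apply]
  positivity

lemma integral_spin_sq (ψp ψm : ℂ → ℂ) :
    ∫ x in ball (0 : ℂ) 1, (spin ψp ψm x) ^ 2
      = (1 / 4) * ∫ x in ball (0 : ℂ) 1, (‖ψp x‖ ^ 2 - ‖ψm x‖ ^ 2) ^ 2 := by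
  rw [← integral_const_mul]
  congr 1 with x
  unfold spin
  ring

lemma norm_sqrt_two_sq : ‖(Real.sqrt 2 : ℂ)‖ ^ 2 = 2 := by
  rw [Complex.norm_real, Real.norm_eq_abs, sq_abs, Real.sq_sqrt (by norm_num)]

lemma norm_inv_sqrt_two_sq : ‖(Real.sqrt 2 : ℂ)⁻¹‖ ^ 2 = 1 / 2 := by
  rw [norm_inv, inv_pow, norm_sqrt_two_sq, one_div]

lemma sqrt_two_ne_zero : (Real.sqrt 2 : ℂ) ≠ 0 := by
  intro h
  have := norm_sqrt_two_sq
  simp [h] at this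

lemma admissibleScalar_sqrt_two_mul {ε : ℝ} {ψ : ℂ → ℂ} (hc : ContinuousOn ψ (closedBall 0 1))
    (hd : ContDiffOn ℝ 1 ψ (ball 0 1)) (hg : IntegrableOn (gradSq ψ) (ball 0 1))
    (hb : ∀ x : ℂ, ‖x‖ = 1 → ψ x = (Real.sqrt 2 : ℂ)⁻¹ * x) :
    AdmissibleScalar ε (fun x => (Real.sqrt 2 : ℂ) * ψ x) := by
  have hc' : ContinuousOn (fun x => (Real.sqrt 2 : ℂ) * ψ x) (closedBall 0 1) :=
    continuousOn_const.mul hc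
  refine ⟨hc', contDiffOn_const.mul hd, ?_, fun x hx => ?_⟩
  · have hp := (integrableOn_ball_of_continuousOn_closedBall
      ((continuousOn_const (c := (1 : ℝ))).sub (hc'.norm.pow 2) |>.pow 2)).const_mul
        (1 / (4 * ε ^ 2))
    refine (hg.add hp).congr (Eventually.of_forall fun x => ?_)
    simp only [gDen, gradSq_const_mul, norm_sqrt_two_sq, Pi.add_apply, Pi.sub_apply, Pi.pow_apply]
    ring
  · simp only [hb x hx]
    rw [mul_inv_cancel_left₀ sqrt_two_ne_zero]

/-- At `β = 1` the two components decouple into two scalar problems. -/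
lemma AdmissiblePair.IGL_le_En_one {ε β : ℝ} {ψp ψm : ℂ → ℂ}
    (h : AdmissiblePair ε β 1 1 ψp ψm) : IGL ε ≤ En ε 1 ψp ψm := by
  have hp := admissibleScalar_sqrt_two_mul (ε := ε) h.1 h.2.2.1 h.integrableOn_gradSq_fst
    fun x hx => by simpa using (h.2.2.2.2.2 x hx).1
  have hm := admissibleScalar_sqrt_two_mul (ε := ε) h.2.1 h.2.2.2.1 h.integrableOn_gradSq_snd
    fun x hx => by simpa using (h.2.2.2.2.2 x hx).2
  have key : En ε 1 ψp ψm = (1 / 2) * (Gn ε (fun x => (Real.sqrt 2 : ℂ) * ψp x)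
      + Gn ε (fun x => (Real.sqrt 2 : ℂ) * ψm x)) := by
    unfold Gn
    rw [← integral_add hp.2.2.1 hm.2.2.1, ← integral_const_mul]
    unfold En
    congr 1 with x
    simp only [eDen, gDen, gradSq_const_mul, norm_mul, mul_pow, norm_sqrt_two_sq]
    ring
  linarith [IGL_le_Gn hp, IGL_le_Gn hm]

lemma AdmissiblePair.IGL_le_En_add_spin {ε β : ℝ} {ψp ψm : ℂ → ℂ}
    (h : AdmissiblePair ε β 1 1 ψp ψm) :
    IGL ε ≤ En ε β ψp ψm
      + (1 - β) * ((1 / ε ^ 2) * ∫ x in ball (0 : ℂ) 1, (spin ψp ψm x) ^ 2) := by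
  refine h.IGL_le_En_one.trans_eq ?_
  rw [(h.change_params ε 1).En_eq, h.En_eq, integral_spin_sq]
  ring

/-- Doubling `ε` controls the potential energy, hence the spin. -/
lemma AdmissiblePair.spin_le {ε β : ℝ} {np nm : ℕ} {ψp ψm : ℂ → ℂ} (hβ : 0 ≤ β)
    (h : AdmissiblePair ε β np nm ψp ψm) :
    β * ((1 / ε ^ 2) * ∫ x in ball (0 : ℂ) 1, (spin ψp ψm x) ^ 2)
      ≤ (4 / 3) * (En ε β ψp ψm - Ival (2 * ε) β np nm) := by
  have h2 := h.change_params (2 * ε) β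
  have hI := Ival_le_En hβ h2
  rw [h2.En_eq] at hI
  rw [h.En_eq, integral_spin_sq]
  set P := ∫ x in ball (0 : ℂ) 1, (‖ψp x‖ ^ 2 + ‖ψm x‖ ^ 2 - 1) ^ 2
  set D := ∫ x in ball (0 : ℂ) 1, (‖ψp x‖ ^ 2 - ‖ψm x‖ ^ 2) ^ 2
  have hP : 0 ≤ (1 / (4 * ε ^ 2)) * P :=
    mul_nonneg (by positivity) (integral_nonneg fun x => sq_nonneg _)
  have e1 : 1 / (4 * (2 * ε) ^ 2) * P = (1 / 4) * (1 / (4 * ε ^ 2) * P) := by ring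
  have e2 : β / (4 * (2 * ε) ^ 2) * D = (1 / 4) * (β / (4 * ε ^ 2) * D) := by ring
  have e3 : β * (1 / ε ^ 2 * (1 / 4 * D)) = β / (4 * ε ^ 2) * D := by ring
  rw [e1, e2] at hI
  rw [e3]
  linarith

/-- Completing a rescaled scalar map by a constant component gives a `[1,0]` competitor. -/
lemma AdmissibleScalar.Ival_one_zero_le {ε ε' β : ℝ} {u : ℂ → ℂ} (hβ : 0 ≤ β)
    (hε : 1 / ε' ^ 2 = (1 + β) / 2 * (1 / ε ^ 2)) (h : AdmissibleScalar ε' u) :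
    Ival ε β 1 0 ≤ (1 / 2) * Gn ε' u := by
  have hden : ∀ x, eDen ε β (fun x => (Real.sqrt 2 : ℂ)⁻¹ * u x)
      (fun _ => (Real.sqrt 2 : ℂ)⁻¹) x = (1 / 2) * gDen ε' u x := by
    intro x
    have e1 : 1 / (4 * ε' ^ 2) = (1 / 4) * ((1 + β) / 2 * (1 / ε ^ 2)) := by rw [← hε]; ring
    simp only [eDen, gDen, gradSq_const_mul, gradSq_const, norm_mul, mul_pow,
      norm_inv_sqrt_two_sq, e1]
    ring
  have hadm : AdmissiblePair ε β 1 0 (fun x => (Real.sqrt 2 : ℂ)⁻¹ * u x)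
      (fun _ => (Real.sqrt 2 : ℂ)⁻¹) := by
    refine ⟨continuousOn_const.mul h.1, continuousOn_const, contDiffOn_const.mul h.2.1,
      contDiffOn_const, ?_, fun x hx => ⟨by simp [h.2.2.2 x hx], by simp⟩⟩
    exact (h.2.2.1.const_mul (1 / 2)).congr (Eventually.of_forall fun x => (hden x).symm)
  refine (Ival_le_En hβ hadm).trans_eq ?_
  simp only [En, Gn, hden, integral_const_mul]

lemma tendsto_const_mul_nhdsGT_zero {c : ℝ} (hc : 0 < c) :
    Tendsto (fun ε : ℝ => c * ε) (nhdsWithin 0 (Ioi 0)) (nhdsWithin 0 (Ioi 0)) := by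
  refine tendsto_nhdsWithin_iff.2 ⟨?_, ?_⟩
  · have : Tendsto (fun ε : ℝ => c * ε) (nhds 0) (nhds (c * 0)) :=
      (continuous_const.mul continuous_id).tendsto 0
    rw [mul_zero] at this
    exact this.mono_left nhdsWithin_le_nhds
  · filter_upwards [self_mem_nhdsWithin] with ε hε
    exact mul_pos hc hε

lemma log_one_div_const_mul {c ε : ℝ} (hc : 0 < c) (hε : 0 < ε) :
    Real.log (1 / (c * ε)) = Real.log (1 / ε) - Real.log c := by
  rw [one_div, one_div, Real.log_inv, Real.log_inv, Real.log_mul hc.ne' hε.ne']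
  ring

/-- Upper bound for the `[1,0]` core energy in terms of the scalar one. -/
lemma core_one_zero_le {β QGL Q10 : ℝ} (hβ0 : 0 < β)
    (hQGL : Tendsto (fun ε => IGL ε - Real.pi * Real.log (1 / ε))
      (nhdsWithin 0 (Ioi 0)) (nhds QGL))
    (hQ10 : Tendsto (fun ε => Ival ε β 1 0 - (Real.pi / 2) * Real.log (1 / ε))
      (nhdsWithin 0 (Ioi 0)) (nhds Q10))
    {u : ℝ → ℂ → ℂ}
    (hu : ∀ ε ∈ Ioo (0 : ℝ) 1, AdmissibleScalar ε (u ε) ∧ Gn ε (u ε) = IGL ε) :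
    2 * Q10 ≤ QGL - (Real.pi / 2) * Real.log (2 / (1 + β)) := by
  set c := Real.sqrt (2 / (1 + β))
  have hpos : 0 < 2 / (1 + β) := by positivity
  have hc : 0 < c := Real.sqrt_pos.2 hpos
  have hc2 : c ^ 2 = 2 / (1 + β) := Real.sq_sqrt hpos.le
  have hlog : Real.log c = Real.log (2 / (1 + β)) / 2 := Real.log_sqrt hpos.le
  have hscale := tendsto_const_mul_nhdsGT_zero hc
  have hlim := ((hQGL.comp hscale).const_mul (1 / 2)).sub_const (Real.pi / 2 * Real.log c)
  have hle := le_of_tendsto_of_tendsto hQ10 hlim (by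
    filter_upwards [self_mem_nhdsWithin,
      hscale.eventually (Ioo_mem_nhdsGT (zero_lt_one (α := ℝ)))] with ε hε hcε
    obtain ⟨hadm, hmin⟩ := hu _ hcε
    have hrel : 1 / (c * ε) ^ 2 = (1 + β) / 2 * (1 / ε ^ 2) := by
      have hε' : ε ≠ 0 := ne_of_gt hε
      rw [mul_pow, hc2]
      field_simp
    have := hadm.Ival_one_zero_le hβ0.le hrel
    rw [hmin] at this
    simp only [Function.comp_apply]
    rw [log_one_div_const_mul hc hε]
    linarith)
  rw [hlog] at hle
  linarith

/-- For `0 < β < 1`: if the three core energies exist, `Q_{[1,1]}(β) ≤ 2·Q_{[1,0]}(β)`,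
scalar minimizers `u_ε` exist with `(1/ε²)∫(1−|u_ε|²)² → 2π`, and `Ψ_ε` are minimizers of
`I_{[1,1]}(ε;β)` with spins `S_ε`, then `liminf_{ε→0⁺}(1/ε²)∫ S_ε² ≥ π/4`. -/
theorem statement5 (β QGL Q11 Q10 : ℝ) (hβ0 : 0 < β) (hβ1 : β < 1)
    (hQGL : Tendsto (fun ε => IGL ε - Real.pi * Real.log (1 / ε))
      (nhdsWithin 0 (Ioi 0)) (nhds QGL))
    (hQ11 : Tendsto (fun ε => Ival ε β 1 1 - Real.pi * Real.log (1 / ε))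
      (nhdsWithin 0 (Ioi 0)) (nhds Q11))
    (hQ10 : Tendsto (fun ε => Ival ε β 1 0 - (Real.pi / 2) * Real.log (1 / ε))
      (nhdsWithin 0 (Ioi 0)) (nhds Q10))
    (hQcomp : Q11 ≤ 2 * Q10)
    (u : ℝ → ℂ → ℂ)
    (hu : ∀ ε ∈ Ioo (0 : ℝ) 1, AdmissibleScalar ε (u ε) ∧ Gn ε (u ε) = IGL ε)
    (huconv : Tendsto
      (fun ε => (1 / ε ^ 2) * ∫ x in ball (0 : ℂ) 1, (1 - ‖u ε x‖ ^ 2) ^ 2)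
      (nhdsWithin 0 (Ioi 0)) (nhds (2 * Real.pi)))
    (Ψp Ψm : ℝ → ℂ → ℂ)
    (hΨ : ∀ ε ∈ Ioo (0 : ℝ) 1,
      AdmissiblePair ε β 1 1 (Ψp ε) (Ψm ε) ∧ En ε β (Ψp ε) (Ψm ε) = Ival ε β 1 1) :
    Real.pi / 4 ≤
      Filter.liminf
        (fun ε => (1 / ε ^ 2) * ∫ x in ball (0 : ℂ) 1, (spin (Ψp ε) (Ψm ε) x) ^ 2)
        (nhdsWithin 0 (Ioi 0)) := by
  have hdomain : ∀ᶠ ε : ℝ in nhdsWithin 0 (Ioi 0), ε ∈ Ioo (0 : ℝ) 1 :=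
    Ioo_mem_nhdsGT zero_lt_one
  have hβ' : 0 < 1 - β := by linarith
  have hgap : Tendsto (fun ε => (IGL ε - Ival ε β 1 1) / (1 - β))
      (nhdsWithin 0 (Ioi 0)) (nhds ((QGL - Q11) / (1 - β))) := by
    refine ((hQGL.sub hQ11).div_const (1 - β)).congr fun ε => ?_
    congr 1
    ring
  have hdouble : Tendsto (fun ε => Ival ε β 1 1 - Ival (2 * ε) β 1 1)
      (nhdsWithin 0 (Ioi 0)) (nhds (Q11 - Q11 + Real.pi * Real.log 2)) := by
    refine ((hQ11.sub (hQ11.comp (tendsto_const_mul_nhdsGT_zero two_pos))).add_const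
      (Real.pi * Real.log 2)).congr' ?_
    filter_upwards [self_mem_nhdsWithin] with ε hε
    simp only [Function.comp_apply]
    rw [log_one_div_const_mul two_pos hε]
    ring
  have hbdd : IsBoundedUnder (· ≤ ·) (nhdsWithin (0 : ℝ) (Ioi 0))
      (fun ε => (1 / ε ^ 2) * ∫ x in ball (0 : ℂ) 1, (spin (Ψp ε) (Ψm ε) x) ^ 2) := by
    refine (hdouble.const_mul (4 / 3 / β)).isBoundedUnder_le.mono_le ?_
    filter_upwards [hdomain] with ε hε
    obtain ⟨hadm, hmin⟩ := hΨ ε hε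
    have := hadm.spin_le hβ0.le
    rw [hmin] at this
    refine le_of_mul_le_mul_left (this.trans_eq ?_) hβ0
    field_simp
  have hlower : (QGL - Q11) / (1 - β) ≤ Filter.liminf
      (fun ε => (1 / ε ^ 2) * ∫ x in ball (0 : ℂ) 1, (spin (Ψp ε) (Ψm ε) x) ^ 2)
      (nhdsWithin 0 (Ioi 0)) := by
    rw [← hgap.liminf_eq]
    refine liminf_le_liminf ?_ hgap.isBoundedUnder_ge hbdd.isCoboundedUnder_ge
    filter_upwards [hdomain] with ε hε
    obtain ⟨hadm, hmin⟩ := hΨ ε hε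
    have := hadm.IGL_le_En_add_spin
    rw [hmin] at this
    rw [div_le_iff₀ hβ']
    linarith
  refine le_trans ?_ hlower
  have hcore := core_one_zero_le hβ0 hQGL hQ10 hu
  have hlog : (1 - β) / 2 ≤ Real.log (2 / (1 + β)) := by
    have := Real.one_sub_inv_le_log_of_pos (x := 2 / (1 + β)) (by positivity)
    rw [inv_div] at this
    linarith
  have := mul_le_mul_of_nonneg_left hlog (by positivity : 0 ≤ Real.pi / 2)
  rw [le_div_iff₀ hβ']
  linarith
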